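/- For a subset A of a topological space and an ordinal ν, let D^ν(A) denote the ν-th iterated derived set of A: D^0(A) = A, D^{ν+1}(A) is the set of accumulation points of D^ν(A), and D^λ(A) = ⋂_{ν<λ} D^ν(A) for limit ordinals λ. Let A and B be nonempty countable closed subsets of Cantor space. Then A and B are homeomorphic as topological spaces if and only if there exists an ordinal ν such that D^ν(A) and D^ν(B) are both nonempty, D^{ν+1}(A) and D^{ν+1}(B) are both empty, and D^ν(A) and D^ν(B) are finite sets with the same cardinality. -/

import Mathlib

open Ordinal

/-- The `ν`-th iterated derived set of `A`: `D^0(A) = A`, `D^{ν+1}(A)` is the set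
of accumulation points of `D^ν(A)`, and intersection at limit stages. -/
noncomputable def iterDerivedSet {X : Type*} [TopologicalSpace X] (A : Set X)
    (ν : Ordinal) : Set X :=
  Ordinal.limitRecOn ν A (fun _ S => derivedSet S)
    (fun ν _ ih => ⋂ (o : Ordinal) (ho : o < ν), ih o ho)

open Set Filter Topology

universe w

section IterDerivedSet

variable {X : Type*} [TopologicalSpace X]

@[simp]
theorem iterDerivedSet_zero (A : Set X) : iterDerivedSet A 0 = A :=
  Ordinal.limitRecOn_zero ..

theorem iterDerivedSet_add_one (A : Set X) (ν : Ordinal) :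
    iterDerivedSet A (ν + 1) = derivedSet (iterDerivedSet A ν) :=
  Ordinal.limitRecOn_add_one ..

theorem iterDerivedSet_limit (A : Set X) {ν : Ordinal} (hν : Order.IsSuccLimit ν) :
    iterDerivedSet A ν = ⋂ (o : Ordinal) (_ : o < ν), iterDerivedSet A o :=
  Ordinal.limitRecOn_limit _ _ _ _ hν

theorem isClosed_iterDerivedSet [T1Space X] {A : Set X} (hA : IsClosed A) (ν : Ordinal) :
    IsClosed (iterDerivedSet A ν) := by
  induction ν using Ordinal.limitRecOn with
  | zero => simpa
  | add_one ν _ => rw [iterDerivedSet_add_one]; exact isClosed_derivedSet _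
  | limit ν hν ih =>
    rw [iterDerivedSet_limit A hν]
    exact isClosed_biInter ih

theorem iterDerivedSet_antitone [T1Space X] {A : Set X} (hA : IsClosed A) :
    Antitone (iterDerivedSet A) := by
  intro α β h
  induction β using Ordinal.limitRecOn with
  | zero => rw [nonpos_iff_eq_zero.1 h]
  | add_one β ih =>
    rcases h.eq_or_lt with rfl | h
    · rfl
    · rw [iterDerivedSet_add_one]
      exact ((isClosed_iff_derivedSet_subset _).1 (isClosed_iterDerivedSet hA β)).trans
        (ih (Order.lt_add_one_iff.1 h))
  | limit β hβ _ =>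
    rcases h.eq_or_lt with rfl | h
    · rfl
    · rw [iterDerivedSet_limit A hβ]
      exact biInter_subset_of_mem (show α ∈ {o | o < β} from h)

theorem iterDerivedSet_subset [T1Space X] {A : Set X} (hA : IsClosed A) (ν : Ordinal) :
    iterDerivedSet A ν ⊆ A := by
  simpa using iterDerivedSet_antitone hA (zero_le (a := ν))

theorem derivedSet_inter_of_isClopen (A : Set X) {C : Set X} (hC : IsClopen C) :
    derivedSet (A ∩ C) = derivedSet A ∩ C := by
  ext x
  refine ⟨fun h => ⟨derivedSet_mono _ _ inter_subset_left h, ?_⟩, fun ⟨h, hx⟩ => ?_⟩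
  · exact (isClosed_iff_derivedSet_subset _).1 hC.isClosed
      (derivedSet_mono _ _ inter_subset_right h)
  · rw [inter_comm]
    exact h.nhds_inter (hC.isOpen.mem_nhds hx)

theorem iterDerivedSet_inter_of_isClopen (A : Set X) {C : Set X} (hC : IsClopen C)
    (ν : Ordinal) : iterDerivedSet (A ∩ C) ν = iterDerivedSet A ν ∩ C := by
  induction ν using Ordinal.limitRecOn with
  | zero => simp
  | add_one ν ih =>
    rw [iterDerivedSet_add_one, iterDerivedSet_add_one, ih, derivedSet_inter_of_isClopen _ hC]
  | limit ν hν ih =>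
    rw [iterDerivedSet_limit _ hν, iterDerivedSet_limit _ hν, iInter₂_congr ih]
    ext x
    simp only [mem_iInter, mem_inter_iff]
    exact ⟨fun h => ⟨fun o ho => (h o ho).1, (h 0 hν.bot_lt).2⟩, fun h o ho => ⟨h.1 o ho, h.2⟩⟩

theorem Topology.IsClosedEmbedding.derivedSet_image {Y : Type*} [TopologicalSpace Y]
    {f : X → Y} (hf : IsClosedEmbedding f) (A : Set X) :
    derivedSet (f '' A) = f '' derivedSet A := by
  refine Subset.antisymm (fun y hy => ?_) (hf.continuous.image_derivedSet hf.injective)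
  obtain ⟨x, rfl⟩ : y ∈ range f := (isClosed_iff_derivedSet_subset _).1 hf.isClosed_range
    (derivedSet_mono _ _ (image_subset_range f A) hy)
  refine ⟨x, ?_, rfl⟩
  rw [mem_derivedSet, accPt_iff_nhds] at hy ⊢
  intro U hU
  rw [hf.isEmbedding.nhds_eq_comap] at hU
  obtain ⟨V, hV, hVU⟩ := hU
  obtain ⟨_, ⟨hyV, a, ha, rfl⟩, hne⟩ := hy V hV
  exact ⟨a, ⟨hVU hyV, ha⟩, fun h => hne (h ▸ rfl)⟩

theorem Topology.IsClosedEmbedding.iterDerivedSet_image {Y : Type*} [TopologicalSpace Y]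
    {f : X → Y} (hf : IsClosedEmbedding f) (A : Set X) (ν : Ordinal) :
    iterDerivedSet (f '' A) ν = f '' iterDerivedSet A ν := by
  induction ν using Ordinal.limitRecOn with
  | zero => simp
  | add_one ν ih =>
    rw [iterDerivedSet_add_one, iterDerivedSet_add_one, ih, hf.derivedSet_image]
  | limit ν hν ih =>
    rw [iterDerivedSet_limit _ hν, iterDerivedSet_limit _ hν, iInter₂_congr ih,
      InjOn.image_biInter_eq ⟨0, hν.bot_lt⟩ hf.injective.injOn]

theorem encard_iterDerivedSet_eq_of_homeomorph {A B : Set X} (hA : IsClosed A) (hB : IsClosed B)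
    (e : A ≃ₜ B) (ν : Ordinal) :
    (iterDerivedSet A ν).encard = (iterDerivedSet B ν).encard := by
  have hf := hA.isClosedEmbedding_subtypeVal
  have hg := hB.isClosedEmbedding_subtypeVal.comp e.isClosedEmbedding
  have h₁ := hf.iterDerivedSet_image univ ν
  have h₂ := hg.iterDerivedSet_image univ ν
  rw [image_univ, Subtype.range_coe] at h₁
  rw [image_univ, e.surjective.range_comp, Subtype.range_coe] at h₂
  rw [h₁, h₂, hf.injective.encard_image, hg.injective.encard_image]

variable [T1Space X]

theorem Set.Finite.derivedSet_eq_empty {A : Set X} (hA : A.Finite) : derivedSet A = ∅ :=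
  eq_empty_of_forall_notMem fun _ hx => Set.Infinite.of_accPt hx hA

theorem iterDerivedSet_eq_empty_of_lt {A : Set X} (hA : IsClosed A) {μ α : Ordinal}
    (hfin : (iterDerivedSet A μ).Finite) (h : μ < α) : iterDerivedSet A α = ∅ := by
  refine subset_empty_iff.1 ((iterDerivedSet_antitone hA (Order.add_one_le_of_lt h)).trans ?_)
  rw [iterDerivedSet_add_one, hfin.derivedSet_eq_empty]

theorem infinite_iterDerivedSet_of_lt {A : Set X} (hA : IsClosed A) {μ α : Ordinal}
    (hne : (iterDerivedSet A μ).Nonempty) (h : α < μ) : (iterDerivedSet A α).Infinite :=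
  fun hfin => hne.ne_empty (iterDerivedSet_eq_empty_of_lt hA hfin h)

theorem encard_iterDerivedSet_eq_of_finite {A B : Set X} (hA : IsClosed A) (hB : IsClosed B)
    {μ : Ordinal.{w}} (hfin : (iterDerivedSet A μ).Finite) (hne : (iterDerivedSet A μ).Nonempty)
    (h : (iterDerivedSet A μ).encard = (iterDerivedSet B μ).encard) (α : Ordinal.{w}) :
    (iterDerivedSet A α).encard = (iterDerivedSet B α).encard := by
  have hfin' : (iterDerivedSet B μ).Finite := by
    rwa [← encard_lt_top_iff, ← h, encard_lt_top_iff]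
  have hne' : (iterDerivedSet B μ).Nonempty := by
    rwa [← encard_pos, ← h, encard_pos]
  rcases lt_trichotomy α μ with hα | rfl | hα
  · rw [(infinite_iterDerivedSet_of_lt hA hne hα).encard_eq,
      (infinite_iterDerivedSet_of_lt hB hne' hα).encard_eq]
  · exact h
  · rw [iterDerivedSet_eq_empty_of_lt hA hfin hα, iterDerivedSet_eq_empty_of_lt hB hfin' hα]

end IterDerivedSet

section Countable

variable {X : Type*} [TopologicalSpace X]

theorem Perfect.eq_empty_of_countable [TopologicalSpace.IsCompletelyMetrizableSpace X] {C : Set X}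
    (hC : Perfect C) (hc : C.Countable) : C = ∅ := by
  have hcard : Cardinal.mk (ℕ → Bool) = 2 ^ Cardinal.aleph0 := by simp
  let := TopologicalSpace.upgradeIsCompletelyMetrizable X
  by_contra hne
  obtain ⟨f, hf, -, hinj⟩ := hC.exists_nat_bool_injection (nonempty_iff_ne_empty.2 hne)
  have : (range f).Countable := hc.mono hf
  have : Countable (ℕ → Bool) :=
    (Equiv.ofInjective f hinj).countable_iff.2 this.to_subtype
  exact (Cardinal.cantor _).not_ge (hcard ▸ Cardinal.mk_le_aleph0)

theorem eq_empty_of_derivedSet_eq [TopologicalSpace.IsCompletelyMetrizableSpace X] {C : Set X}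
    (h : derivedSet C = C) (hc : C.Countable) : C = ∅ :=
  (perfect_iff_eq_derivedSet.2 h.symm).eq_empty_of_countable hc

theorem exists_iterDerivedSet_eq_empty [TopologicalSpace.IsCompletelyMetrizableSpace X]
    [Small.{w} (Set X)] [T1Space X] {A : Set X} (hA : IsClosed A) (hc : A.Countable) :
    ∃ ν : Ordinal.{w}, iterDerivedSet A ν = ∅ := by
  have key : ∀ α β : Ordinal.{w}, α < β → iterDerivedSet A α = iterDerivedSet A β →
      iterDerivedSet A α = ∅ := fun α β hlt h => by
    refine eq_empty_of_derivedSet_eq (Subset.antisymm ?_ ?_)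
      (hc.mono (iterDerivedSet_subset hA α))
    · exact (isClosed_iff_derivedSet_subset _).1 (isClosed_iterDerivedSet hA α)
    · rw [← iterDerivedSet_add_one]
      exact h.subset.trans (iterDerivedSet_antitone hA (Order.add_one_le_of_lt hlt))
  have := not_injective_of_ordinal (iterDerivedSet A : Ordinal.{w} → Set X)
  simp only [Function.Injective, not_forall] at this
  obtain ⟨α, β, h, hne⟩ := this
  rcases lt_or_gt_of_ne hne with hlt | hlt
  · exact ⟨α, key α β hlt h⟩
  · exact ⟨β, key β α hlt h.symm⟩

theorem exists_finite_nonempty_iterDerivedSet [TopologicalSpace.IsCompletelyMetrizableSpace X]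
    [CompactSpace X] [Small.{w} (Set X)] [T1Space X] {A : Set X} (hA : IsClosed A) (hc : A.Countable)
    (hne : A.Nonempty) :
    ∃ ν : Ordinal.{w}, (iterDerivedSet A ν).Finite ∧ (iterDerivedSet A ν).Nonempty := by
  obtain ⟨μ, hμ, hmin⟩ := WellFounded.has_min (wellFounded_lt (α := Ordinal.{w}))
    {ν : Ordinal.{w} | iterDerivedSet A ν = ∅} (exists_iterDerivedSet_eq_empty hA hc)
  have hmin' : ∀ ν < μ, (iterDerivedSet A ν).Nonempty := fun ν hν =>
    nonempty_iff_ne_empty.2 fun h => hmin ν h hν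
  induction μ using Ordinal.limitRecOn with
  | zero => simp [hne.ne_empty] at hμ
  | add_one ν _ =>
    refine ⟨ν, ?_, hmin' ν (lt_add_one ν)⟩
    by_contra hinf
    obtain ⟨x, hx⟩ := Set.Infinite.exists_accPt_principal hinf
    have : x ∈ iterDerivedSet A (ν + 1) := by rwa [iterDerivedSet_add_one]
    simp_all
  | limit ν hν _ =>
    exfalso
    have : Nonempty (Iio ν) := ⟨⟨0, hν.bot_lt⟩⟩
    have hanti : Antitone fun o : Iio ν => iterDerivedSet A o :=
      fun a b h => iterDerivedSet_antitone hA h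
    obtain ⟨x, hx⟩ := IsCompact.nonempty_iInter_of_directed_nonempty_isCompact_isClosed
      (fun o : Iio ν => iterDerivedSet A o) hanti.directed_ge (fun o => hmin' o o.2)
      (fun o => (isClosed_iterDerivedSet hA _).isCompact) (fun o => isClosed_iterDerivedSet hA _)
    have : x ∈ iterDerivedSet A ν := by
      rw [iterDerivedSet_limit A hν]
      simpa using hx
    simp_all

theorem exists_isClopen_inter_eq_of_finite [CompactSpace X] [T2Space X]
    [TotallyDisconnectedSpace X] {A F : Set X} (hA : IsClosed A) (hF : F.Finite)
    (hFA : F ⊆ A \ derivedSet A) : ∃ E, IsClopen E ∧ A ∩ E = F := by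
  have hcl : IsClosed (A \ F) := by
    rw [isClosed_iff_derivedSet_subset]
    intro x hx
    have hx' : x ∈ derivedSet A := derivedSet_mono _ _ sdiff_subset hx
    exact ⟨(isClosed_iff_derivedSet_subset A).1 hA hx', fun hxF => (hFA hxF).2 hx'⟩
  obtain ⟨E, hE, hFE, hEA⟩ := exists_clopen_of_closed_subset_open hF.isClosed hcl.isOpen_compl
    (fun x hx h => h.2 hx)
  refine ⟨E, hE, Subset.antisymm (fun x hx => ?_) fun x hx => ⟨(hFA hx).1, hFE hx⟩⟩
  by_contra hxF
  exact hEA hx.2 ⟨hx.1, hxF⟩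

theorem infinite_iterDerivedSet_diff [TopologicalSpace.IsCompletelyMetrizableSpace X] [T1Space X]
    {A : Set X} (hA : IsClosed A) (hc : A.Countable) {μ ν : Ordinal} (h : μ < ν)
    (hne : (iterDerivedSet A ν).Nonempty) :
    (iterDerivedSet A μ \ derivedSet (iterDerivedSet A μ)).Infinite := by
  intro hfin
  set S := iterDerivedSet A μ
  have hS : derivedSet S ⊆ S :=
    (isClosed_iff_derivedSet_subset _).1 (isClosed_iterDerivedSet hA μ)
  have hD : derivedSet (derivedSet S) = derivedSet S := by
    conv_rhs => rw [← sdiff_union_of_subset hS, derivedSet_union, hfin.derivedSet_eq_empty,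
      empty_union]
  have hempty := eq_empty_of_derivedSet_eq hD
    (hc.mono (hS.trans (iterDerivedSet_subset hA μ)))
  have := iterDerivedSet_antitone hA (Order.add_one_le_of_lt h)
  rw [iterDerivedSet_add_one, hempty] at this
  exact hne.ne_empty (subset_empty_iff.1 this)

/-- Two countable closed sets whose iterated derived sets have the same cardinalities (with all
infinite cardinalities identified). -/
structure SameCantorBendixsonType (K L : Set X) : Prop where
  isClosed_left : IsClosed K
  isClosed_right : IsClosed L
  countable_left : K.Countable
  countable_right : L.Countable
  encard_eq (ν : Ordinal.{w}) : (iterDerivedSet K ν).encard = (iterDerivedSet L ν).encard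

namespace SameCantorBendixsonType

variable {K L : Set X}

theorem symm (h : SameCantorBendixsonType.{w} K L) : SameCantorBendixsonType.{w} L K :=
  ⟨h.isClosed_right, h.isClosed_left, h.countable_right, h.countable_left,
    fun ν => (h.encard_eq ν).symm⟩

theorem nonempty_iff (h : SameCantorBendixsonType.{w} K L) : K.Nonempty ↔ L.Nonempty := by
  have := h.encard_eq 0
  rw [iterDerivedSet_zero, iterDerivedSet_zero] at this
  rw [← encard_pos, this, encard_pos]

theorem inter [T1Space X] (h : SameCantorBendixsonType.{w} K L) {C E : Set X}
    (hC : IsClopen C) (hE : IsClopen E) {μ : Ordinal.{w}}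
    (hfin : (iterDerivedSet K μ ∩ C).Finite) (hne : (iterDerivedSet K μ ∩ C).Nonempty)
    (heq : (iterDerivedSet K μ ∩ C).encard = (iterDerivedSet L μ ∩ E).encard) :
    SameCantorBendixsonType.{w} (K ∩ C) (L ∩ E) where
  isClosed_left := h.isClosed_left.inter hC.isClosed
  isClosed_right := h.isClosed_right.inter hE.isClosed
  countable_left := h.countable_left.mono inter_subset_left
  countable_right := h.countable_right.mono inter_subset_left
  encard_eq := encard_iterDerivedSet_eq_of_finite (h.isClosed_left.inter hC.isClosed)
    (h.isClosed_right.inter hE.isClosed) (by rwa [iterDerivedSet_inter_of_isClopen _ hC])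
    (by rwa [iterDerivedSet_inter_of_isClopen _ hC])
    (by rwa [iterDerivedSet_inter_of_isClopen _ hC, iterDerivedSet_inter_of_isClopen _ hE])

variable [TopologicalSpace.IsCompletelyMetrizableSpace X] [CompactSpace X]
  [T2Space X] [TotallyDisconnectedSpace X] [Small.{w} (Set X)]

theorem exists_split_of_nonempty (h : SameCantorBendixsonType.{w} K L) {C : Set X}
    (hC : IsClopen C) {ν : Ordinal.{w}} (hfin : (iterDerivedSet K ν).Finite)
    (hne : (iterDerivedSet K ν ∩ Cᶜ).Nonempty) :
    ∃ E, IsClopen E ∧ SameCantorBendixsonType.{w} (K ∩ C) (L ∩ E) ∧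
      SameCantorBendixsonType.{w} (K ∩ Cᶜ) (L ∩ Eᶜ) := by
  have hKcl := h.isClosed_left.inter hC.isClosed
  rcases (K ∩ C).eq_empty_or_nonempty with hKC | hKC
  · refine ⟨∅, isClopen_empty, ?_, ?_⟩
    · rw [hKC, inter_empty]
      exact ⟨isClosed_empty, isClosed_empty, countable_empty, countable_empty, fun _ => rfl⟩
    · have : K ∩ Cᶜ = K := inter_eq_left.2 fun x hx hxC => (hKC ▸ ⟨hx, hxC⟩ : x ∈ (∅ : Set X))
      simpa [this] using h
  obtain ⟨μ, hμfin, hμne⟩ := exists_finite_nonempty_iterDerivedSet.{w} hKcl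
    (h.countable_left.mono inter_subset_left) hKC
  rw [iterDerivedSet_inter_of_isClopen _ hC] at hμfin hμne
  have hμν : μ ≤ ν := by
    by_contra! hlt
    rw [iterDerivedSet_eq_empty_of_lt h.isClosed_left hfin hlt, empty_inter] at hμne
    exact not_nonempty_empty hμne
  have hLfin : (iterDerivedSet L ν).Finite := by
    rwa [← encard_lt_top_iff, ← h.encard_eq, encard_lt_top_iff]
  have hLne : (iterDerivedSet L ν).Nonempty := by
    rw [← encard_pos, ← h.encard_eq, encard_pos]
    exact hne.mono inter_subset_left
  have hle : (iterDerivedSet K μ ∩ C).encard ≤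
      (iterDerivedSet L μ \ derivedSet (iterDerivedSet L μ)).encard := by
    rcases hμν.eq_or_lt with rfl | hlt
    · rw [hLfin.derivedSet_eq_empty, sdiff_empty, ← h.encard_eq]
      exact encard_le_encard inter_subset_left
    · rw [(infinite_iterDerivedSet_diff h.isClosed_right h.countable_right hlt hLne).encard_eq]
      exact le_top
  obtain ⟨F, hF, hFcard⟩ := exists_subset_encard_eq hle
  obtain ⟨E, hE, hEF⟩ := exists_isClopen_inter_eq_of_finite
    (isClosed_iterDerivedSet h.isClosed_right μ)
    (by rw [← encard_lt_top_iff, hFcard]; exact hμfin.encard_lt_top) hF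
  have h₁ := h.inter hC hE hμfin hμne (by rw [hEF, hFcard])
  refine ⟨E, hE, h₁, h.inter hC.compl hE.compl (hfin.subset inter_subset_left) hne ?_⟩
  have h₂ := h₁.encard_eq ν
  rw [iterDerivedSet_inter_of_isClopen _ hC, iterDerivedSet_inter_of_isClopen _ hE] at h₂
  have h₃ := h.encard_eq ν
  rw [← encard_sdiff_add_encard_inter (iterDerivedSet K ν) C,
    ← encard_sdiff_add_encard_inter (iterDerivedSet L ν) E, h₂] at h₃
  exact ENat.add_left_injective_of_ne_top
    (hLfin.subset inter_subset_left).encard_lt_top.ne h₃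

theorem exists_split (h : SameCantorBendixsonType.{w} K L) {C : Set X} (hC : IsClopen C) :
    ∃ E, IsClopen E ∧ SameCantorBendixsonType.{w} (K ∩ C) (L ∩ E) ∧
      SameCantorBendixsonType.{w} (K ∩ Cᶜ) (L ∩ Eᶜ) := by
  rcases K.eq_empty_or_nonempty with rfl | hK
  · have hL : L = ∅ := by simpa [not_nonempty_iff_eq_empty] using h.nonempty_iff
    exact ⟨∅, isClopen_empty, by simpa [hL] using h, by simpa [hL] using h⟩
  obtain ⟨ν, hfin, x, hx⟩ := exists_finite_nonempty_iterDerivedSet.{w} h.isClosed_left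
    h.countable_left hK
  by_cases hxC : x ∈ C
  · obtain ⟨E, hE, h₁, h₂⟩ := h.exists_split_of_nonempty hC.compl hfin ⟨x, hx, by simpa⟩
    exact ⟨Eᶜ, hE.compl, by simpa using h₂, by simpa using h₁⟩
  · exact h.exists_split_of_nonempty hC hfin ⟨x, hx, hxC⟩

end SameCantorBendixsonType

end Countable

section SplittingScheme

variable {X : Type*} (C : List Bool → Set X)

/-- The cells obtained from `A` by successively splitting along the sets `C s`; addresses are
written with the most recent choice first. -/
def splitCell (A : Set X) : List Bool → Set X
  | [] => A
  | b :: s => splitCell A s ∩ cond b (C s) (C s)ᶜ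

/-- The reversed initial segment of length `n` of a branch. -/
def branchPrefix (σ : ℕ → Bool) : ℕ → List Bool
  | 0 => []
  | n + 1 => σ n :: branchPrefix σ n

open Classical in
/-- The address of length `n` of the cell containing `x`. -/
noncomputable def splitAddress (x : X) : ℕ → List Bool
  | 0 => []
  | n + 1 => decide (x ∈ C (splitAddress x n)) :: splitAddress x n

open Classical in
/-- The branch followed by `x` in the splitting scheme `C`. -/
noncomputable def splitBranch (x : X) (n : ℕ) : Bool :=
  decide (x ∈ C (splitAddress C x n))

theorem branchPrefix_length (σ : ℕ → Bool) (n : ℕ) : (branchPrefix σ n).length = n := by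
  induction n with
  | zero => rfl
  | succ n ih => simp [branchPrefix, ih]

theorem branchPrefix_splitBranch (x : X) (n : ℕ) :
    branchPrefix (splitBranch C x) n = splitAddress C x n := by
  induction n with
  | zero => rfl
  | succ n ih => simp [branchPrefix, splitAddress, splitBranch, ih]

theorem mem_splitCell_splitAddress {A : Set X} {x : X} (hx : x ∈ A) (n : ℕ) :
    x ∈ splitCell C A (splitAddress C x n) := by
  induction n with
  | zero => exact hx
  | succ n ih =>
    refine ⟨ih, ?_⟩
    by_cases h : x ∈ C (splitAddress C x n) <;> simp [h]

theorem splitBranch_eq {A : Set X} {x : X} {σ : ℕ → Bool}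
    (h : ∀ n, x ∈ splitCell C A (branchPrefix σ n)) : splitBranch C x = σ := by
  have key : ∀ n, splitAddress C x n = branchPrefix σ n → splitBranch C x n = σ n := by
    intro n hn
    have := (h (n + 1)).2
    rw [splitBranch, hn]
    cases hσ : σ n <;> simp_all
  have : ∀ n, splitAddress C x n = branchPrefix σ n := by
    intro n
    induction n with
    | zero => rfl
    | succ n ih => rw [branchPrefix, ← key n ih, ← ih]; rfl
  exact funext fun n => key n (this n)

theorem splitBranch_injective
    (hsep : ∀ x y : X, x ≠ y → ∃ n, ∀ s : List Bool, s.length = n → ¬(x ∈ C s ↔ y ∈ C s)) :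
    Function.Injective (splitBranch C) := by
  intro x y hxy
  by_contra hne
  obtain ⟨n, hn⟩ := hsep x y hne
  have hadd : splitAddress C x n = splitAddress C y n := by
    rw [← branchPrefix_splitBranch, ← branchPrefix_splitBranch, hxy]
  refine hn (splitAddress C x n)
    (by rw [← branchPrefix_splitBranch, branchPrefix_length]) ?_
  have := congrFun hxy n
  rw [splitBranch, splitBranch, ← hadd] at this
  simpa using this

variable [TopologicalSpace X] {C}

theorem isClosed_splitCell {A : Set X} (hA : IsClosed A) (hC : ∀ s, IsClopen (C s))
    (s : List Bool) : IsClosed (splitCell C A s) := by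
  induction s with
  | nil => exact hA
  | cons b s ih =>
    refine ih.inter ?_
    cases b
    · exact (hC s).compl.isClosed
    · exact (hC s).isClosed

theorem IsClopen.eventually_mem_iff {U : Set X} (hU : IsClopen U) (x : X) :
    ∀ᶠ y in 𝓝 x, (y ∈ U ↔ x ∈ U) := by
  by_cases hx : x ∈ U
  · filter_upwards [hU.isOpen.mem_nhds hx] with y hy using by simp [hx, hy]
  · filter_upwards [hU.compl.isOpen.mem_nhds hx] with y hy
    exact iff_of_false hy hx

theorem eventually_splitAddress_eq (hC : ∀ s, IsClopen (C s)) (x : X) (n : ℕ) :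
    ∀ᶠ y in 𝓝 x, splitAddress C y n = splitAddress C x n := by
  induction n with
  | zero => exact Eventually.of_forall fun _ => rfl
  | succ n ih =>
    filter_upwards [ih, (hC (splitAddress C x n)).eventually_mem_iff x] with y h₁ h₂
    simp [splitAddress, h₁, h₂]

theorem continuous_splitBranch (hC : ∀ s, IsClopen (C s)) : Continuous (splitBranch C) := by
  refine continuous_pi fun n => continuous_iff_continuousAt.2 fun x => ?_
  refine tendsto_nhds_of_eventually_eq ?_
  filter_upwards [eventually_splitAddress_eq hC x n,
    (hC (splitAddress C x n)).eventually_mem_iff x] with y h₁ h₂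
  simp [splitBranch, h₁, h₂]

theorem splitBranch_image [CompactSpace X] {A : Set X} (hA : IsClosed A)
    (hC : ∀ s, IsClopen (C s)) :
    splitBranch C '' A = {σ | ∀ n, (splitCell C A (branchPrefix σ n)).Nonempty} := by
  ext σ
  constructor
  · rintro ⟨x, hx, rfl⟩ n
    rw [branchPrefix_splitBranch]
    exact ⟨x, mem_splitCell_splitAddress C hx n⟩
  · intro h
    obtain ⟨x, hx⟩ := IsCompact.nonempty_iInter_of_sequence_nonempty_isCompact_isClosed
      (fun n => splitCell C A (branchPrefix σ n)) (fun n => inter_subset_left) h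
      (isClosed_splitCell hA hC _).isCompact fun n => isClosed_splitCell hA hC _
    rw [mem_iInter] at hx
    exact ⟨x, hx 0, splitBranch_eq C hx⟩

theorem nonempty_homeomorph_of_splitCell [CompactSpace X] {A B : Set X} (hA : IsClosed A)
    (hB : IsClosed B) {E : List Bool → Set X} (hC : ∀ s, IsClopen (C s))
    (hE : ∀ s, IsClopen (E s)) (hCinj : Function.Injective (splitBranch C))
    (hEinj : Function.Injective (splitBranch E))
    (h : ∀ s, (splitCell C A s).Nonempty ↔ (splitCell E B s).Nonempty) :
    Nonempty (A ≃ₜ B) := by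
  have emb : ∀ (K : Set X) (D : List Bool → Set X), IsClosed K → (∀ s, IsClopen (D s)) →
      Function.Injective (splitBranch D) → Nonempty (K ≃ₜ splitBranch D '' K) := by
    intro K D hK hD hinj
    have := isCompact_iff_compactSpace.1 hK.isCompact
    have he : IsClosedEmbedding (K.domRestrict (splitBranch D)) :=
      ((continuous_splitBranch hD).comp continuous_subtype_val).isClosedEmbedding
        (hinj.comp Subtype.val_injective)
    exact ⟨he.isEmbedding.toHomeomorph.trans (Homeomorph.setCongr (range_domRestrict _ _))⟩
  obtain ⟨e⟩ := emb A C hA hC hCinj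
  obtain ⟨e'⟩ := emb B E hB hE hEinj
  have himg : splitBranch C '' A = splitBranch E '' B := by
    rw [splitBranch_image hA hC, splitBranch_image hB hE]
    simp only [h]
  exact ⟨(e.trans (Homeomorph.setCongr himg)).trans e'.symm⟩

end SplittingScheme

/-- The clopen set of points of the Cantor space whose `k`-th coordinate is `true`. -/
def coordSet (k : ℕ) : Set (ℕ → Bool) := {x | x k = true}

theorem isClopen_coordSet (k : ℕ) : IsClopen (coordSet k) :=
  (isClopen_discrete {true}).preimage (continuous_apply k)

theorem exists_length_separated {C : List Bool → Set (ℕ → Bool)} (f : ℕ → ℕ)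
    (hC : ∀ k s, s.length = f k → C s = coordSet k) (x y : ℕ → Bool) (hxy : x ≠ y) :
    ∃ n, ∀ s : List Bool, s.length = n → ¬(x ∈ C s ↔ y ∈ C s) := by
  obtain ⟨k, hk⟩ := Function.ne_iff.1 hxy
  refine ⟨f k, fun s hs h => hk ?_⟩
  rw [hC k s hs] at h
  exact Bool.eq_iff_iff.2 h

/-- Vaught's back-and-forth criterion for closed subsets of the Cantor space. -/
theorem nonempty_homeomorph_of_backAndForth {A B : Set (ℕ → Bool)} (hA : IsClosed A)
    (hB : IsClosed B) (R : Set (ℕ → Bool) → Set (ℕ → Bool) → Prop)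
    (hne : ∀ K L, R K L → (K.Nonempty ↔ L.Nonempty))
    (hforth : ∀ K L C, R K L → IsClopen C →
      ∃ E, IsClopen E ∧ R (K ∩ C) (L ∩ E) ∧ R (K ∩ Cᶜ) (L ∩ Eᶜ))
    (hback : ∀ K L E, R K L → IsClopen E →
      ∃ C, IsClopen C ∧ R (K ∩ C) (L ∩ E) ∧ R (K ∩ Cᶜ) (L ∩ Eᶜ))
    (hAB : R A B) : Nonempty (A ≃ₜ B) := by
  have step : ∀ (n : ℕ) (K L : Set (ℕ → Bool)), ∃ C E : Set (ℕ → Bool),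
      IsClopen C ∧ IsClopen E ∧
      (R K L → R (K ∩ C) (L ∩ E) ∧ R (K ∩ Cᶜ) (L ∩ Eᶜ)) ∧
      (∀ k, n = 2 * k → C = coordSet k) ∧ (∀ k, n = 2 * k + 1 → E = coordSet k) := by
    intro n K L
    obtain ⟨k, rfl | rfl⟩ := n.even_or_odd'
    · by_cases hR : R K L
      · obtain ⟨E, hE, h⟩ := hforth K L _ hR (isClopen_coordSet k)
        exact ⟨_, E, isClopen_coordSet k, hE, fun _ => h,
          fun j hj => by rw [show k = j by omega], fun j hj => by omega⟩
      · exact ⟨_, ∅, isClopen_coordSet k, isClopen_empty, fun h => absurd h hR,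
          fun j hj => by rw [show k = j by omega], fun j hj => by omega⟩
    · by_cases hR : R K L
      · obtain ⟨C, hC, h⟩ := hback K L _ hR (isClopen_coordSet k)
        exact ⟨C, _, hC, isClopen_coordSet k, fun _ => h,
          fun j hj => by omega, fun j hj => by rw [show k = j by omega]⟩
      · exact ⟨∅, _, isClopen_empty, isClopen_coordSet k, fun h => absurd h hR,
          fun j hj => by omega, fun j hj => by rw [show k = j by omega]⟩
  choose c e hc he hR hcoord hcoord' using step
  let T : List Bool → Set (ℕ → Bool) × Set (ℕ → Bool) := fun s =>
    List.rec (A, B) (fun b t P => (P.1 ∩ cond b (c t.length P.1 P.2) (c t.length P.1 P.2)ᶜ,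
      P.2 ∩ cond b (e t.length P.1 P.2) (e t.length P.1 P.2)ᶜ)) s
  let C : List Bool → Set (ℕ → Bool) := fun s => c s.length (T s).1 (T s).2
  let E : List Bool → Set (ℕ → Bool) := fun s => e s.length (T s).1 (T s).2
  have hT : ∀ s, R (T s).1 (T s).2 := by
    intro s
    induction s with
    | nil => exact hAB
    | cons b s ih =>
      cases b
      · exact (hR s.length _ _ ih).2
      · exact (hR s.length _ _ ih).1
  have hTC : ∀ s, splitCell C A s = (T s).1 := by
    intro s
    induction s with
    | nil => rfl
    | cons b s ih => rw [splitCell, ih]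
  have hTE : ∀ s, splitCell E B s = (T s).2 := by
    intro s
    induction s with
    | nil => rfl
    | cons b s ih => rw [splitCell, ih]
  refine nonempty_homeomorph_of_splitCell hA hB (fun s => hc _ _ _) (fun s => he _ _ _)
    (splitBranch_injective C (exists_length_separated (2 * ·)
      fun k s hs => hcoord _ _ _ k hs))
    (splitBranch_injective E (exists_length_separated (2 * · + 1)
      fun k s hs => hcoord' _ _ _ k hs)) fun s => ?_
  rw [hTC, hTE]
  exact hne _ _ (hT s)

theorem SameCantorBendixsonType.nonempty_homeomorph {A B : Set (ℕ → Bool)}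
    (hAB : SameCantorBendixsonType.{w} A B) : Nonempty (A ≃ₜ B) := by
  refine nonempty_homeomorph_of_backAndForth hAB.isClosed_left hAB.isClosed_right
    SameCantorBendixsonType.{w} (fun _ _ h => h.nonempty_iff)
    (fun _ _ _ h hC => h.exists_split hC) (fun _ _ _ h hE => ?_) hAB
  obtain ⟨C, hC, h₁, h₂⟩ := h.symm.exists_split hE
  exact ⟨C, hC, h₁.symm, h₂.symm⟩

/-- Two nonempty countable closed subsets of Cantor space are homeomorphic iff
they have the same Cantor-Bendixson rank `(ν, n)`: for some ordinal `ν`, the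
`ν`-th derived sets are both nonempty and finite with the same cardinality, and
the `(ν+1)`-st derived sets are both empty. -/
theorem countable_closed_homeomorph_iff_cantorBendixson
    (A B : Set (ℕ → Bool)) (hA : A.Nonempty) (hB : B.Nonempty)
    (hAc : A.Countable) (hBc : B.Countable)
    (hAcl : IsClosed A) (hBcl : IsClosed B) :
    Nonempty (A ≃ₜ B) ↔
      ∃ ν : Ordinal,
        (iterDerivedSet A ν).Nonempty ∧ (iterDerivedSet B ν).Nonempty ∧
        iterDerivedSet A (ν + 1) = ∅ ∧ iterDerivedSet B (ν + 1) = ∅ ∧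
        (iterDerivedSet A ν).Finite ∧ (iterDerivedSet B ν).Finite ∧
        (iterDerivedSet A ν).ncard = (iterDerivedSet B ν).ncard := by
  constructor
  · rintro ⟨e⟩
    refine Exists.imp (fun ν ⟨hfin, hne⟩ => ?_)
      (exists_finite_nonempty_iterDerivedSet hAcl hAc hA)
    have h := encard_iterDerivedSet_eq_of_homeomorph hAcl hBcl e ν
    have hfin' : (iterDerivedSet B ν).Finite := by
      rwa [← encard_lt_top_iff, ← h, encard_lt_top_iff]
    have hne' : (iterDerivedSet B ν).Nonempty := by
      rwa [← encard_pos, ← h, encard_pos]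
    exact ⟨hne, hne', iterDerivedSet_eq_empty_of_lt hAcl hfin (lt_add_one ν),
      iterDerivedSet_eq_empty_of_lt hBcl hfin' (lt_add_one ν), hfin, hfin',
      congrArg ENat.toNat h⟩
  · rintro ⟨ν, hne, -, -, -, hfin, hfin', hcard⟩
    have hAB : SameCantorBendixsonType A B :=
      ⟨hAcl, hBcl, hAc, hBc, encard_iterDerivedSet_eq_of_finite hAcl hBcl hfin hne (by
        rw [← hfin.cast_ncard_eq, ← hfin'.cast_ncard_eq, hcard])⟩
    exact hAB.nonempty_homeomorph
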